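/- arXiv:2507.16610 — 2 statements merged into one kernel-verified Lean document; each statement's English description precedes it below -/
import Mathlib

section
/- Let H be a 2×2 Hermitian complex matrix that is diagonal in the standard basis (H₀₁ = 0) with real diagonal entries h₁ = H₀₀ ≠ h₃ = H₁₁. Then for every C ∈ [0,1], the coherence-constrained maximal work satisfies ξ₂(C) = |h₁ − h₃|·√(1 − C²); in particular, the function C ↦ ξ₂(C) is strictly decreasing on [0,1] and vanishes at C = 1. -/
open Matrix BigOperators
open scoped ComplexOrder

/-- The l1-norm of coherence of a matrix in the standard basis. -/
noncomputable def coh {d : ℕ} (ρ : Matrix (Fin d) (Fin d) ℂ) : ℝ :=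
  ∑ i, ∑ j, if i ≠ j then ‖ρ i j‖ else 0

/-- A density matrix: positive semidefinite with unit trace. -/
def IsDensityMatrix {d : ℕ} (ρ : Matrix (Fin d) (Fin d) ℂ) : Prop :=
  ρ.PosSemidef ∧ ρ.trace = 1

/-- A unitary matrix. -/
def IsUnitaryMat {d : ℕ} (U : Matrix (Fin d) (Fin d) ℂ) : Prop :=
  U * Uᴴ = 1 ∧ Uᴴ * U = 1

/-- The coherence-constrained maximal work: the supremum of Tr[Hρ] − Tr[H UρU†]
over all density matrices ρ of coherence C and all unitaries U preserving that coherence. -/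
noncomputable def ccmw (d : ℕ) (H : Matrix (Fin d) (Fin d) ℂ) (C : ℝ) : ℝ :=
  sSup { w : ℝ | ∃ ρ U : Matrix (Fin d) (Fin d) ℂ,
    IsDensityMatrix ρ ∧ coh ρ = C ∧ IsUnitaryMat U ∧ coh (U * ρ * Uᴴ) = C ∧
    w = ((H * ρ).trace).re - ((H * (U * ρ * Uᴴ)).trace).re }

theorem coh_fin_two (ρ : Matrix (Fin 2) (Fin 2) ℂ) : coh ρ = ‖ρ 0 1‖ + ‖ρ 1 0‖ := by
  simp [coh, Fin.sum_univ_two]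

theorem IsDensityMatrix.conj_unitary {d : ℕ} {ρ U : Matrix (Fin d) (Fin d) ℂ}
    (hρ : IsDensityMatrix ρ) (hU : IsUnitaryMat U) : IsDensityMatrix (U * ρ * Uᴴ) := by
  refine ⟨hρ.1.mul_mul_conjTranspose_same U, ?_⟩
  rw [Matrix.trace_mul_comm, ← Matrix.mul_assoc, hU.2, Matrix.one_mul, hρ.2]

theorem IsDensityMatrix.sq_le_one_sub_coh_sq {ρ : Matrix (Fin 2) (Fin 2) ℂ}
    (hρ : IsDensityMatrix ρ) : (2 * (ρ 0 0).re - 1) ^ 2 ≤ 1 - coh ρ ^ 2 := by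
  have hdet := (Complex.le_def.1 hρ.1.det_nonneg).1
  have h10 : ρ 1 0 = star (ρ 0 1) := (hρ.1.isHermitian.apply 1 0).symm
  have h00 : (ρ 0 0).im = 0 := Complex.conj_eq_iff_im.1 (hρ.1.isHermitian.apply 0 0)
  have htr : (ρ 0 0).re + (ρ 1 1).re = 1 := by
    simpa [Matrix.trace_fin_two] using congrArg Complex.re hρ.2
  have hn : ‖ρ 0 1‖ ^ 2 = (ρ 0 1).re * (ρ 0 1).re + (ρ 0 1).im * (ρ 0 1).im := by
    rw [Complex.sq_norm, Complex.normSq_apply]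
  have h11 : (ρ 1 1).re = 1 - (ρ 0 0).re := by linarith
  rw [coh_fin_two, h10, norm_star]
  simp only [Matrix.det_fin_two, h10, Complex.zero_re, Complex.sub_re, Complex.mul_re, h00,
    Complex.star_def, Complex.conj_re, Complex.conj_im, h11] at hdet
  nlinarith

theorem IsDensityMatrix.re_trace_diagonal_mul {H ρ : Matrix (Fin 2) (Fin 2) ℂ}
    (hρ : IsDensityMatrix ρ) (hH : H.IsHermitian) (hdiag : H 0 1 = 0) :
    ((H * ρ).trace).re = (H 1 1).re + ((H 0 0).re - (H 1 1).re) * (ρ 0 0).re := by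
  have h10 : H 1 0 = 0 := by rw [← hH.apply 1 0, hdiag, star_zero]
  have h00 : (H 0 0).im = 0 := Complex.conj_eq_iff_im.1 (hH.apply 0 0)
  have h11 : (H 1 1).im = 0 := Complex.conj_eq_iff_im.1 (hH.apply 1 1)
  have htr : (ρ 0 0).re + (ρ 1 1).re = 1 := by
    simpa [Matrix.trace_fin_two] using congrArg Complex.re hρ.2
  have : (ρ 1 1).re = 1 - (ρ 0 0).re := by linarith
  simp only [Matrix.trace_fin_two, Matrix.mul_apply, Fin.sum_univ_two, hdiag, h10, zero_mul,
    add_zero, zero_add, Complex.add_re, Complex.mul_re, h00, h11, sub_zero, this]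
  ring

theorem isDensityMatrix_of_pure {a b : ℝ} (h : a * (1 - a) = b ^ 2) :
    IsDensityMatrix !![(a : ℂ), b; b, 1 - a] := by
  have h' : (a : ℂ) * (1 - a) = b ^ 2 := by exact_mod_cast h
  refine ⟨?_, by simp [Matrix.trace_fin_two]⟩
  have key : !![(a : ℂ), b; b, 1 - a] = !![(a : ℂ), b; b, 1 - a]ᴴ * !![(a : ℂ), b; b, 1 - a] := by
    ext i j
    fin_cases i <;> fin_cases j <;>
      simp [Matrix.mul_apply, Fin.sum_univ_two] <;>
      first | ring1 | linear_combination h'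
  rw [key]
  exact Matrix.posSemidef_conjTranspose_mul_self _

theorem isUnitaryMat_swap : IsUnitaryMat !![(0 : ℂ), 1; 1, 0] := by
  constructor <;> ext i j <;> fin_cases i <;> fin_cases j <;>
    simp [Matrix.mul_apply, Fin.sum_univ_two]

theorem swap_conj (a b c d : ℂ) :
    !![(0 : ℂ), 1; 1, 0] * !![a, b; c, d] * !![(0 : ℂ), 1; 1, 0]ᴴ = !![d, c; b, a] := by
  ext i j
  fin_cases i <;> fin_cases j <;> simp [Matrix.mul_apply, Fin.sum_univ_two]

/-- The optimal work is attained by a pure state and the exchange of the two levels. -/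
theorem isGreatest_work {H : Matrix (Fin 2) (Fin 2) ℂ} (hH : H.IsHermitian)
    (hdiag : H 0 1 = 0) {C : ℝ} (hC : C ∈ Set.Icc (0 : ℝ) 1) :
    IsGreatest { w : ℝ | ∃ ρ U : Matrix (Fin 2) (Fin 2) ℂ,
      IsDensityMatrix ρ ∧ coh ρ = C ∧ IsUnitaryMat U ∧ coh (U * ρ * Uᴴ) = C ∧
      w = ((H * ρ).trace).re - ((H * (U * ρ * Uᴴ)).trace).re }
      (|(H 0 0).re - (H 1 1).re| * Real.sqrt (1 - C ^ 2)) := by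
  obtain ⟨hC0, hC1⟩ := hC
  have hs : Real.sqrt (1 - C ^ 2) ^ 2 = 1 - C ^ 2 := Real.sq_sqrt (by nlinarith)
  constructor
  · obtain ⟨t, ht, hΔ⟩ : ∃ t : ℝ, t ^ 2 = 1 - C ^ 2 ∧
        |(H 0 0).re - (H 1 1).re| * Real.sqrt (1 - C ^ 2) = ((H 0 0).re - (H 1 1).re) * t := by
      rcases abs_cases ((H 0 0).re - (H 1 1).re) with ⟨h, -⟩ | ⟨h, -⟩
      · exact ⟨Real.sqrt (1 - C ^ 2), hs, by rw [h]⟩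
      · exact ⟨-Real.sqrt (1 - C ^ 2), by rw [neg_sq, hs], by rw [h]; ring⟩
    have hρ : IsDensityMatrix !![(((1 + t) / 2 : ℝ) : ℂ), (C / 2 : ℝ);
        (C / 2 : ℝ), 1 - ((1 + t) / 2 : ℝ)] :=
      isDensityMatrix_of_pure (by linear_combination -ht / 4)
    have hcoh : ‖((C / 2 : ℝ) : ℂ)‖ + ‖((C / 2 : ℝ) : ℂ)‖ = C := by
      rw [Complex.norm_of_nonneg (by positivity)]; ring
    refine ⟨_, _, hρ, (coh_fin_two _).trans hcoh, isUnitaryMat_swap, ?_, ?_⟩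
    · rw [swap_conj]
      exact (coh_fin_two _).trans hcoh
    · rw [(hρ.conj_unitary isUnitaryMat_swap).re_trace_diagonal_mul hH hdiag,
        hρ.re_trace_diagonal_mul hH hdiag, swap_conj, hΔ]
      simp only [Matrix.of_apply, Matrix.cons_val_zero, Matrix.cons_val', Complex.sub_re,
        Complex.ofReal_re, Complex.one_re]
      ring
  · rintro w ⟨ρ, U, hρ, hc, hU, hc', rfl⟩
    have hσ := hρ.conj_unitary hU
    have h₁ := Real.abs_le_sqrt hρ.sq_le_one_sub_coh_sq
    have h₂ := Real.abs_le_sqrt hσ.sq_le_one_sub_coh_sq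
    rw [hc, abs_le] at h₁
    rw [hc', abs_le] at h₂
    rw [hρ.re_trace_diagonal_mul hH hdiag, hσ.re_trace_diagonal_mul hH hdiag,
      add_sub_add_left_eq_sub, ← mul_sub]
    refine (le_abs_self _).trans ?_
    rw [abs_mul]
    gcongr
    rw [abs_le]
    constructor <;> linarith [h₁.1, h₁.2, h₂.1, h₂.2]

theorem stmt2 (H : Matrix (Fin 2) (Fin 2) ℂ) (hH : H.IsHermitian)
    (hdiag : H 0 1 = 0)
    (hne : (H 0 0).re ≠ (H 1 1).re) :
    (∀ C ∈ Set.Icc (0 : ℝ) 1,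
      ccmw 2 H C = |(H 0 0).re - (H 1 1).re| * Real.sqrt (1 - C ^ 2)) ∧
    StrictAntiOn (ccmw 2 H) (Set.Icc (0 : ℝ) 1) ∧
    ccmw 2 H 1 = 0 := by
  have h : ∀ C ∈ Set.Icc (0 : ℝ) 1,
      ccmw 2 H C = |(H 0 0).re - (H 1 1).re| * Real.sqrt (1 - C ^ 2) :=
    fun C hC => (isGreatest_work hH hdiag hC).csSup_eq
  refine ⟨h, fun x hx y hy hxy => ?_, by simp [h 1 (by simp)]⟩
  rw [h x hx, h y hy]
  refine mul_lt_mul_of_pos_left (Real.sqrt_lt_sqrt ?_ ?_) (abs_pos.2 (sub_ne_zero.2 hne))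
  · nlinarith [hy.1, hy.2]
  · nlinarith [hx.1]
end

section
/- Let α > 0, φ ∈ ℝ, and let H be the 3×3 Hermitian matrix with H₀₁ = H₁₂ = α·e^{iφ}, H₁₀ = H₂₁ = α·e^{−iφ}, and all other entries 0. For C ∈ [0, 2], define ξ₃(C) as the supremum of ⟨ψ, Hψ⟩ − ⟨φ', Hφ'⟩ over all unit vectors ψ, φ' ∈ ℂ³ whose l1-coherence equals C. Then ξ₃(C) = 2αC for 0 ≤ C ≤ 1; ξ₃(C) = α(C + 1) for 1 ≤ C ≤ 5/3; and ξ₃(C) = 2α(C − f(C)) for 5/3 ≤ C ≤ 2, where f(C) = (2/9)·(√(1 + C) − √(1 − C/2))². -/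
open Matrix BigOperators
open scoped ComplexOrder

/-- The l1-norm of coherence of a (pure state) vector in the standard basis:
the l1-coherence of the rank-one projector |ψ⟩⟨ψ|. -/
noncomputable def cohVec {d : ℕ} (ψ : Fin d → ℂ) : ℝ :=
  ∑ i, ∑ j, if i ≠ j then ‖ψ i‖ * ‖ψ j‖ else 0

/-- The pure-state coherence-constrained extractable work: the supremum of
⟨ψ, Hψ⟩ − ⟨φ, Hφ⟩ over all unit vectors ψ, φ of l1-coherence C. -/
noncomputable def xip (d : ℕ) (H : Matrix (Fin d) (Fin d) ℂ) (C : ℝ) : ℝ :=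
  sSup { w : ℝ | ∃ ψ φ : Fin d → ℂ,
    (∑ i, ‖ψ i‖ ^ 2 = 1) ∧ (∑ i, ‖φ i‖ ^ 2 = 1) ∧
    cohVec ψ = C ∧ cohVec φ = C ∧
    w = (star ψ ⬝ᵥ (H *ᵥ ψ)).re - (star φ ⬝ᵥ (H *ᵥ φ)).re }

/-- The Hermitian tridiagonal matrix with constant off-diagonal entry `α e^{iφ}`. -/
noncomputable def chainMatrix (α φ : ℝ) : Matrix (Fin 3) (Fin 3) ℂ :=
  !![0, (α : ℂ) * Complex.exp (Complex.I * (φ : ℂ)), 0;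
     (α : ℂ) * Complex.exp (-Complex.I * (φ : ℂ)), 0,
       (α : ℂ) * Complex.exp (Complex.I * (φ : ℂ));
     0, (α : ℂ) * Complex.exp (-Complex.I * (φ : ℂ)), 0]

lemma cohVec_three (ψ : Fin 3 → ℂ) :
    cohVec ψ = 2 * (‖ψ 0‖ * ‖ψ 1‖ + ‖ψ 1‖ * ‖ψ 2‖ + ‖ψ 0‖ * ‖ψ 2‖) := by
  simp [cohVec, Fin.sum_univ_three]
  ring

lemma chainMatrix_form (α φ : ℝ) (ψ : Fin 3 → ℂ) :
    star ψ ⬝ᵥ (chainMatrix α φ *ᵥ ψ) =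
      α * (star (ψ 0) * Complex.exp (Complex.I * φ) * ψ 1
        + star (ψ 1) * Complex.exp (-Complex.I * φ) * ψ 0
        + star (ψ 1) * Complex.exp (Complex.I * φ) * ψ 2
        + star (ψ 2) * Complex.exp (-Complex.I * φ) * ψ 1) := by
  simp [chainMatrix, dotProduct, mulVec, Fin.sum_univ_three]
  ring

lemma norm_exp_I_mul (φ : ℝ) : ‖Complex.exp (Complex.I * φ)‖ = 1 := by
  rw [mul_comm]; exact Complex.norm_exp_ofReal_mul_I φ

lemma norm_exp_neg_I_mul (φ : ℝ) : ‖Complex.exp (-Complex.I * φ)‖ = 1 := by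
  have := norm_exp_I_mul (-φ)
  rwa [Complex.ofReal_neg, mul_neg, ← neg_mul] at this

lemma abs_chainMatrix_form_le (α φ : ℝ) (hα : 0 < α) (ψ : Fin 3 → ℂ) :
    |(star ψ ⬝ᵥ (chainMatrix α φ *ᵥ ψ)).re| ≤
      α * (2 * ‖ψ 1‖ * (‖ψ 0‖ + ‖ψ 2‖)) := by
  refine (Complex.abs_re_le_norm _).trans ?_
  rw [chainMatrix_form, norm_mul, Complex.norm_real, Real.norm_of_nonneg hα.le]
  refine mul_le_mul_of_nonneg_left ?_ hα.le
  refine norm_add₄_le.trans (le_of_eq ?_)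
  simp only [norm_mul, norm_star, norm_exp_I_mul, norm_exp_neg_I_mul]
  ring

/-- The state with moduli `a, |b|, c` whose phases are aligned with `chainMatrix α φ`. -/
noncomputable def alignedState (φ a b c : ℝ) : Fin 3 → ℂ :=
  ![(a : ℂ), b * Complex.exp (-Complex.I * φ), c * Complex.exp (-Complex.I * φ) ^ 2]

lemma alignedState_form (α φ a b c : ℝ) :
    (star (alignedState φ a b c) ⬝ᵥ (chainMatrix α φ *ᵥ alignedState φ a b c)).re =
      α * (2 * b * (a + c)) := by
  have hs : (starRingEnd ℂ) (Complex.exp (-Complex.I * φ)) = Complex.exp (Complex.I * φ) := by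
    rw [← Complex.exp_conj]; simp
  have he : Complex.exp (Complex.I * φ) * Complex.exp (-Complex.I * φ) = 1 := by
    rw [← Complex.exp_add]; simp
  have : star (alignedState φ a b c) ⬝ᵥ (chainMatrix α φ *ᵥ alignedState φ a b c) =
      ((α * (2 * b * (a + c)) : ℝ) : ℂ) := by
    rw [chainMatrix_form]
    simp only [alignedState, Matrix.cons_val_zero, Matrix.cons_val_one, Matrix.cons_val,
      RCLike.star_def, map_mul, map_pow, Complex.conj_ofReal, hs]
    generalize Complex.exp (Complex.I * φ) = z at he
    generalize Complex.exp (-Complex.I * φ) = w at he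
    push_cast
    linear_combination (α * b * (2 * a + (c : ℂ) * (z * w + 1) + c * (z * w + 1)) : ℂ) * he
  rw [this, Complex.ofReal_re]

lemma alignedState_norms (φ a b c : ℝ) :
    ‖alignedState φ a b c 0‖ = |a| ∧ ‖alignedState φ a b c 1‖ = |b| ∧
      ‖alignedState φ a b c 2‖ = |c| := by
  refine ⟨?_, ?_, ?_⟩ <;>
    simp only [alignedState, Matrix.cons_val_zero, Matrix.cons_val_one, Matrix.cons_val,
      norm_mul, norm_pow, norm_exp_neg_I_mul, Complex.norm_real, Real.norm_eq_abs,
      one_pow, mul_one]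

lemma xip_chainMatrix (α φ : ℝ) (hα : 0 < α) (C M : ℝ)
    (hM : ∀ a b c : ℝ, 0 ≤ a → 0 ≤ b → 0 ≤ c → a ^ 2 + b ^ 2 + c ^ 2 = 1 →
      2 * (a * b + b * c + a * c) = C → 2 * b * (a + c) ≤ M)
    (hex : ∃ a b c : ℝ, 0 ≤ a ∧ 0 ≤ b ∧ 0 ≤ c ∧ a ^ 2 + b ^ 2 + c ^ 2 = 1 ∧
      2 * (a * b + b * c + a * c) = C ∧ 2 * b * (a + c) = M) :
    xip 3 (chainMatrix α φ) C = 2 * α * M := by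
  refine IsGreatest.csSup_eq ⟨?_, ?_⟩
  · obtain ⟨a, b, c, ha, hb, hc, h1, h2, h3⟩ := hex
    obtain ⟨p0, p1, p2⟩ := alignedState_norms φ a b c
    obtain ⟨m0, m1, m2⟩ := alignedState_norms φ a (-b) c
    rw [abs_neg] at m1
    rw [abs_of_nonneg] at p0 p1 p2 m0 m1 m2 <;> try assumption
    refine ⟨alignedState φ a b c, alignedState φ a (-b) c, ?_, ?_, ?_, ?_, ?_⟩
    · rw [Fin.sum_univ_three, p0, p1, p2, h1]
    · rw [Fin.sum_univ_three, m0, m1, m2, h1]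
    · rw [cohVec_three, p0, p1, p2, h2]
    · rw [cohVec_three, m0, m1, m2, h2]
    · rw [alignedState_form, alignedState_form, ← h3]
      ring
  · rintro w ⟨ψ, χ, hψ, hχ, cψ, cχ, rfl⟩
    rw [cohVec_three] at cψ cχ
    rw [Fin.sum_univ_three] at hψ hχ
    have h1 := mul_le_mul_of_nonneg_left (hM _ _ _ (norm_nonneg (ψ 0)) (norm_nonneg (ψ 1))
      (norm_nonneg (ψ 2)) hψ cψ) hα.le
    have h2 := mul_le_mul_of_nonneg_left (hM _ _ _ (norm_nonneg (χ 0)) (norm_nonneg (χ 1))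
      (norm_nonneg (χ 2)) hχ cχ) hα.le
    have h3 := (abs_le.mp (abs_chainMatrix_form_le α φ hα ψ)).2
    have h4 := (abs_le.mp (abs_chainMatrix_form_le α φ hα χ)).1
    linarith

/-- Two nonnegative reals with prescribed sum and product. -/
lemma exists_nonneg_add_mul {s p : ℝ} (hs : 0 ≤ s) (hp : 0 ≤ p) (h : 4 * p ≤ s ^ 2) :
    ∃ a c : ℝ, 0 ≤ a ∧ 0 ≤ c ∧ a + c = s ∧ a * c = p := by
  have hd : 0 ≤ s ^ 2 - 4 * p := by linarith
  have hle : Real.sqrt (s ^ 2 - 4 * p) ≤ s := Real.sqrt_le_iff.mpr ⟨hs, by linarith⟩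
  refine ⟨(s + Real.sqrt (s ^ 2 - 4 * p)) / 2, (s - Real.sqrt (s ^ 2 - 4 * p)) / 2,
    by positivity, by linarith, by ring, ?_⟩
  linear_combination (-1 / 4) * Real.sq_sqrt hd

theorem stmt15 (α φ : ℝ) (hα : 0 < α) :
    let H : Matrix (Fin 3) (Fin 3) ℂ :=
      !![0, (α : ℂ) * Complex.exp (Complex.I * (φ : ℂ)), 0;
         (α : ℂ) * Complex.exp (-Complex.I * (φ : ℂ)), 0,
           (α : ℂ) * Complex.exp (Complex.I * (φ : ℂ));
         0, (α : ℂ) * Complex.exp (-Complex.I * (φ : ℂ)), 0]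
    (∀ C : ℝ, 0 ≤ C → C ≤ 1 → xip 3 H C = 2 * α * C) ∧
    (∀ C : ℝ, 1 ≤ C → C ≤ 5 / 3 → xip 3 H C = α * (C + 1)) ∧
    (∀ C : ℝ, 5 / 3 ≤ C → C ≤ 2 →
      xip 3 H C =
        2 * α * (C - (2 / 9) * (Real.sqrt (1 + C) - Real.sqrt (1 - C / 2)) ^ 2)) := by
  intro H
  refine ⟨fun C h0 h1 => ?_, fun C h1 h2 => ?_, fun C h1 h2 => ?_⟩
  · refine xip_chainMatrix α φ hα C C (fun a b c ha hb hc _ h => ?_) ?_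
    · nlinarith [mul_nonneg ha hc]
    · obtain ⟨a, b, ha, hb, hs, hp⟩ :=
        exists_nonneg_add_mul (s := Real.sqrt (1 + C)) (p := C / 2) (by positivity)
          (by positivity) (by rw [Real.sq_sqrt (by linarith)]; linarith)
      have hsq : (a + b) ^ 2 = 1 + C := by rw [hs, Real.sq_sqrt (by linarith)]
      refine ⟨a, b, 0, ha, hb, le_rfl, ?_, ?_, ?_⟩ <;> linarith
  · have key := xip_chainMatrix α φ hα C ((C + 1) / 2)
      (fun a b c _ _ _ hn h => by nlinarith [sq_nonneg (a + c - b)]) ?_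
    · rw [show α * (C + 1) = 2 * α * ((C + 1) / 2) by ring]
      exact key
    · have ht := Real.sq_sqrt (show 0 ≤ 1 + C by linarith)
      obtain ⟨a, c, ha, hc, hs, hp⟩ :=
        exists_nonneg_add_mul (s := Real.sqrt (1 + C) / 2) (p := (C - 1) / 4) (by positivity)
          (by linarith) (by rw [div_pow, ht]; linarith)
      have hsq : (a + c) ^ 2 = (1 + C) / 4 := by rw [hs, div_pow, ht]; ring
      refine ⟨a, a + c, c, ha, by positivity, hc, ?_, ?_, ?_⟩ <;> linarith
  · refine xip_chainMatrix α φ hα C _ (fun a b c ha hb hc hn h => ?_) ?_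
    all_goals
      have ht := Real.sq_sqrt (show 0 ≤ 1 + C by linarith)
      have hu := Real.sq_sqrt (show 0 ≤ 1 - C / 2 by linarith)
      have ht0 := Real.sqrt_nonneg (1 + C)
      have hu0 := Real.sqrt_nonneg (1 - C / 2)
      have hut : 4 * Real.sqrt (1 - C / 2) ≤ Real.sqrt (1 + C) :=
        abs_le_of_sq_le_sq' (by nlinarith) ht0 |>.2
      generalize Real.sqrt (1 + C) = t at *
      generalize Real.sqrt (1 - C / 2) = u at *
    · have hsum : a + b + c = t := by
        refine (sq_eq_sq₀ (by positivity) ht0).mp ?_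
        linarith
      -- The constraint `4ac ≤ (a + c)²` bounds the distance of `a + c` to `2t/3`.
      have hlow : 2 * (t - u) ≤ 3 * (a + c) := by
        have : |3 * (a + c) - 2 * t| ≤ 2 * u := by
          refine abs_le_of_sq_le_sq ?_ (by positivity)
          obtain rfl : b = t - a - c := by linarith
          nlinarith [sq_nonneg (a - c)]
        linarith [(abs_le.mp this).1]
      obtain rfl : b = t - a - c := by linarith
      nlinarith [mul_nonneg (sub_nonneg.mpr hlow)
        (show 0 ≤ 3 * (a + c) - (t + 2 * u) by linarith)]
    · refine ⟨(t - u) / 3, (t + 2 * u) / 3, (t - u) / 3, by linarith, by linarith, by linarith,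
        ?_, ?_, ?_⟩ <;> linarith
end
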